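/- Let G be a finite simple graph on n vertices and let E' ⊆ E(G) be such that the subgraph of the line graph L(G) induced by E' is acyclic and |E'| ≥ n − 1. Then |E'| = n − 1 and the spanning subgraph (V(G), E') of G is a Hamiltonian path of G. -/

import Mathlib

open SimpleGraph in
/-- The cycle graph embeds in its own line graph. -/
lemma cycle_in_lineGraph (n : ℕ) :
    (cycleGraph (n + 3)).IsContained (cycleGraph (n + 3)).lineGraph := by
  have hadj : ∀ i : Fin (n + 3), (cycleGraph (n + 3)).Adj i (i + 1) := by
    intro i
    rw [cycleGraph_adj]
    right
    simp
  have h2 : ∀ j : Fin (n + 3), j + 1 + 1 ≠ j := by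
    intro j h
    rw [add_assoc, add_eq_left] at h
    have := congrArg Fin.val h
    rw [Fin.val_add] at this
    simp at this
    rw [Nat.mod_eq_of_lt (by omega)] at this
    omega
  have hinj : ∀ i j : Fin (n + 3), s(i, i + 1) = s(j, j + 1) → i = j := by
    intro i j h
    rw [Sym2.eq_iff] at h
    rcases h with h | ⟨h, h'⟩
    · exact h.1
    · subst h
      exact absurd h' (h2 j)
  refine ⟨⟨⟨fun i => ⟨s(i, i + 1), hadj i⟩, ?_⟩, ?_⟩⟩
  · intro i j hij
    rw [lineGraph_adj_iff_exists]
    refine ⟨fun h => hij.ne (hinj i j (congrArg Subtype.val h)), ?_⟩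
    rw [cycleGraph_adj] at hij
    rcases hij with h | h
    · have : i = j + 1 := by rw [← h]; abel
      exact ⟨i, by simp, by simp [this]⟩
    · have : j = i + 1 := by rw [← h]; abel
      exact ⟨j, by simp [this], by simp⟩
  · intro i j h
    exact hinj i j (congrArg Subtype.val h)

open SimpleGraph in
/-- A graph with acyclic line graph is acyclic. -/
lemma acyclic_of_lineGraph {V : Type*} (H : SimpleGraph V) (h : H.lineGraph.IsAcyclic) :
    H.IsAcyclic := by
  rw [isAcyclic_iff_free_cycleGraph] at h ⊢
  intro n hn hc
  obtain ⟨m, rfl⟩ := Nat.exists_eq_add_of_le' hn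
  exact h (m + 3) hn ((cycle_in_lineGraph m).trans hc.lineGraph)

open SimpleGraph in
/-- A graph with acyclic line graph has no vertex with three neighbours. -/
lemma no_three_of_lineGraph {V : Type*} (H : SimpleGraph V) (h : H.lineGraph.IsAcyclic)
    {v a b c : V} (ha : H.Adj v a) (hb : H.Adj v b) (hc : H.Adj v c)
    (hab : a ≠ b) (hac : a ≠ c) (hbc : b ≠ c) : False := by
  classical
  have key : ∀ {x y : V} (hx : H.Adj v x) (hy : H.Adj v y), x ≠ y →
      H.lineGraph.Adj ⟨s(v, x), hx⟩ ⟨s(v, y), hy⟩ := by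
    intro x y hx hy hxy
    rw [lineGraph_adj_iff_exists]
    refine ⟨fun h => hxy ?_, v, by simp, by simp⟩
    have := congrArg Subtype.val h
    exact Sym2.congr_right.1 this
  exact h.cliqueFree le_rfl _
    (is3Clique_iff.2 ⟨_, _, _, key ha hb hab, key ha hc hac, key hb hc hbc, rfl⟩)

open SimpleGraph in
/-- A finite connected graph in which no vertex has three neighbours has a Hamiltonian path. -/
lemma exists_ham {V : Type*} [Finite V] [Nonempty V] (H : SimpleGraph V)
    (hconn : H.Connected)
    (h3 : ∀ {v a b c : V}, H.Adj v a → H.Adj v b → H.Adj v c →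
      a ≠ b → a ≠ c → b ≠ c → False) :
    ∃ (u v : V) (p : H.Walk u v), p.IsPath ∧ ∀ w, w ∈ p.support := by
  obtain ⟨u, v, p, hp, hmax⟩ := Walk.exists_isPath_forall_isPath_length_le_length H
  refine ⟨u, v, p, hp, ?_⟩
  by_contra hcon
  push Not at hcon
  obtain ⟨w, hw⟩ := hcon
  obtain ⟨q⟩ := hconn.preconnected u w
  obtain ⟨d, -, hd1, hd2⟩ := q.exists_boundary_dart {x | x ∈ p.support} (by simp) hw
  obtain ⟨⟨x, y⟩, hxy⟩ := d
  change x ∈ p.support at hd1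
  change ¬ y ∈ p.support at hd2
  change H.Adj x y at hxy
  rw [Walk.mem_support_iff_exists_getVert] at hd1
  obtain ⟨i, rfl, hi⟩ := hd1
  by_cases h0 : i = 0
  · subst h0
    rw [Walk.getVert_zero] at hxy
    have := hmax _ _ (Walk.cons hxy.symm p) (hp.cons hd2)
    simp at this
  by_cases hl : i = p.length
  · subst hl
    rw [Walk.getVert_length] at hxy
    have := hmax _ _ (p.concat hxy) (hp.concat hd2 hxy)
    simp at this
  obtain ⟨j, rfl⟩ := Nat.exists_eq_succ_of_ne_zero h0
  refine h3 (p.adj_getVert_succ (i := j) (by omega)).symm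
    (p.adj_getVert_succ (i := j + 1) (by omega)) hxy ?_ ?_ ?_
  · intro h
    have := hp.getVert_injOn (by simp; omega) (by simp; omega) h
    omega
  · rintro rfl
    exact hd2 (p.getVert_mem_support _)
  · rintro rfl
    exact hd2 (p.getVert_mem_support _)

/-- Let `G` be a finite simple graph on `n` vertices and `E'` a set of edges
of `G` such that the subgraph of the line graph `L(G)` induced by `E'` is acyclic and
`|E'| ≥ n - 1`.  Then `|E'| = n - 1` and the spanning subgraph `(V(G), E')` of `G` is a
Hamiltonian path of `G`. -/
theorem stmt14 {V : Type*} [Fintype V] [Nonempty V] [DecidableEq V]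
    (G : SimpleGraph V) (E' : Set G.edgeSet)
    (hacyc : (G.lineGraph.induce E').IsAcyclic)
    (hcard : Fintype.card V - 1 ≤ E'.ncard) :
    E'.ncard = Fintype.card V - 1 ∧
      ∃ (u v : V) (p : G.Walk u v), p.IsPath ∧ p.IsHamiltonian ∧
        ∀ e : Sym2 V, e ∈ p.edges ↔ ∃ e' ∈ E', (e' : Sym2 V) = e := by
  obtain ⟨H, hH⟩ : ∃ H : SimpleGraph V, H.edgeSet = Subtype.val '' E' := by
    refine ⟨SimpleGraph.fromEdgeSet (Subtype.val '' E'), ?_⟩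
    rw [SimpleGraph.edgeSet_fromEdgeSet]
    ext e
    simp only [Set.mem_sdiff, and_iff_left_iff_imp]
    rintro ⟨e', -, rfl⟩
    exact G.not_isDiag_of_mem_edgeSet e'.2
  have hmem : ∀ e : Sym2 V, e ∈ H.edgeSet ↔ ∃ e' ∈ E', (e' : Sym2 V) = e := by
    intro e; rw [hH]; rfl
  have hle : H ≤ G := by
    rw [← SimpleGraph.edgeSet_subset_edgeSet, hH]
    rintro _ ⟨e, -, rfl⟩
    exact e.2
  have hsub : ∀ e (he : e ∈ H.edgeSet),
      (⟨e, SimpleGraph.edgeSet_mono hle he⟩ : G.edgeSet) ∈ E' := by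
    intro e he
    obtain ⟨e', h1, rfl⟩ := (hmem e).1 he
    exact h1
  have hL : H.lineGraph.IsAcyclic := by
    refine hacyc.comap
      (⟨fun e => ⟨⟨e.1, SimpleGraph.edgeSet_mono hle e.2⟩, hsub e.1 e.2⟩, ?_⟩ :
        H.lineGraph →g G.lineGraph.induce E') ?_
    · intro a b hab
      rw [SimpleGraph.lineGraph_adj_iff_exists] at hab
      rw [SimpleGraph.induce_adj, SimpleGraph.lineGraph_adj_iff_exists]
      refine ⟨fun h => hab.1 (Subtype.ext ?_), hab.2⟩
      exact congrArg (fun x : G.edgeSet => (x : Sym2 V)) h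
    · intro a b h
      exact Subtype.ext (congrArg (fun x => x.1.1) h)
  have hn : H.edgeSet.ncard = E'.ncard := by
    rw [hH, Set.ncard_image_of_injective _ Subtype.val_injective]
  have hpos : 0 < Fintype.card V := Fintype.card_pos
  obtain ⟨T, hHT, -, hT⟩ := (SimpleGraph.connected_top (V := V)).exists_isTree_le_of_le_of_isAcyclic
    le_top (acyclic_of_lineGraph H hL)
  have hTc := (SimpleGraph.isTree_iff_connected_and_card.1 hT).2
  rw [Nat.card_coe_set_eq, Nat.card_eq_fintype_card] at hTc
  have hes : H.edgeSet = T.edgeSet :=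
    Set.eq_of_subset_of_ncard_le (SimpleGraph.edgeSet_mono hHT) (by omega) (Set.toFinite _)
  have hc : H.edgeSet.ncard = Fintype.card V - 1 := by rw [hes]; omega
  have hHTe : H = T := SimpleGraph.edgeSet_injective hes
  subst hHTe
  refine ⟨hn ▸ hc, ?_⟩
  obtain ⟨u, v, p, hp, hall⟩ := exists_ham H hT.connected (no_three_of_lineGraph H hL)
  have hham := hp.isHamiltonian_of_mem hall
  have hpe : (p.edges.toFinset : Set (Sym2 V)) = H.edgeSet := by
    refine Set.eq_of_subset_of_ncard_le ?_ ?_ (Set.toFinite _)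
    · intro e he
      exact p.edges_subset_edgeSet (by simpa using he)
    · rw [hc, Set.ncard_coe_finset, List.toFinset_card_of_nodup hp.isTrail.edges_nodup,
        SimpleGraph.Walk.length_edges, hham.length_eq]
  have hp' : (p.mapLe hle).IsPath := hp.mapLe hle
  refine ⟨u, v, p.mapLe hle, hp', hp'.isHamiltonian_of_mem (by simpa using hall), ?_⟩
  intro e
  rw [← hmem, ← hpe]
  simp
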